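/- Let (X_1,…,X_n) be drawn from a product distribution μ on 𝒳^n. Then for any k-pass streaming algorithm M on the n-element input stream, MIC(M, μ) ≥ Σ_{i=1}^{k} Σ_{j=1}^{n} Σ_{ℓ=1}^{j} I(M_{(i,j)}; X_ℓ | M_{(≤i,ℓ-1)}, M_{(≤i-1,j)}) ≥ MIC_cond(M, μ). Consequently, if M uses s bits of memory, then MIC_cond(M, μ) ≤ k·s·n. -/

import Mathlib

open scoped Classical
open Finset

noncomputable section

namespace MultiPassIC

/-- Probability of an event under a probability mass function `p` on a finite sample space. -/
def pr {Ω : Type} [Fintype Ω] (p : Ω → ℝ) (E : Ω → Prop) : ℝ :=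
  ∑ ω, if E ω then p ω else 0

/-- `p` is a probability mass function on the finite type `Ω`. -/
structure IsPMF {Ω : Type} [Fintype Ω] (p : Ω → ℝ) : Prop where
  nonneg : ∀ ω, 0 ≤ p ω
  sum_one : ∑ ω, p ω = 1

/-- Shannon entropy (base 2) of the random variable `A` under `p`. -/
def H {Ω : Type} [Fintype Ω] {α : Type} [Fintype α] (p : Ω → ℝ) (A : Ω → α) : ℝ :=
  -∑ a, pr p (fun ω => A ω = a) * Real.logb 2 (pr p (fun ω => A ω = a))

/-- Conditional mutual information `I(A ; B ∣ C)` (base 2), with the usual conventions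
for vanishing probabilities. -/
def condMI {Ω : Type} [Fintype Ω] {α β γ : Type} [Fintype α] [Fintype β] [Fintype γ]
    (p : Ω → ℝ) (A : Ω → α) (B : Ω → β) (C : Ω → γ) : ℝ :=
  ∑ a, ∑ b, ∑ c,
    pr p (fun ω => A ω = a ∧ B ω = b ∧ C ω = c) *
      Real.logb 2 ((pr p (fun ω => C ω = c) *
          pr p (fun ω => A ω = a ∧ B ω = b ∧ C ω = c)) /
        (pr p (fun ω => A ω = a ∧ C ω = c) * pr p (fun ω => B ω = b ∧ C ω = c)))

/-- Mutual information `I(A ; B)` (base 2). -/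
def MI {Ω : Type} [Fintype Ω] {α β : Type} [Fintype α] [Fintype β]
    (p : Ω → ℝ) (A : Ω → α) (B : Ω → β) : ℝ :=
  condMI p A B (fun _ => (0 : Fin 1))

/-- `X 0, …, X (n-1)` (the first `n` stream elements) are mutually independent under `p`,
i.e. they are drawn from a product distribution. -/
def IsProduct {Ω : Type} [Fintype Ω] {𝒳 : Type} (p : Ω → ℝ) (n : ℕ) (X : ℕ → Ω → 𝒳) : Prop :=
  ∀ x : ℕ → 𝒳,
    pr p (fun ω => ∀ j < n, X j ω = x j) =
      ∏ j ∈ Finset.range n, pr p (fun ω => X j ω = x j)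

/-- A `k`-pass streaming algorithm on the input stream `X 0, …, X (n-1)` (0-indexed;
the paper's `X_j` is `X (j-1)`), over a finite sample space `Ω` with pmf `p`.
`S` is the finite set of memory states, `Rv` the value space of the per-step private
randomness, `init` the initial memory state `M₀`, `R i j` the private randomness used at
step `j` of pass `i` (0-indexed), and `f i j` the corresponding transition function.
The field `indep` states that the initial state, all the per-step random seeds, and the
input stream are mutually independent. -/
structure Alg (Ω : Type) [Fintype Ω] (p : Ω → ℝ) (𝒳 : Type) [Fintype 𝒳]
    (n k : ℕ) (X : ℕ → Ω → 𝒳) where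
  S : Type
  fintS : Fintype S
  Rv : Type
  fintR : Fintype Rv
  init : Ω → S
  R : ℕ → ℕ → Ω → Rv
  f : ℕ → ℕ → 𝒳 → S → Rv → S
  indep : ∀ (m : S) (r : ℕ → ℕ → Rv) (x : ℕ → 𝒳),
    pr p (fun ω => init ω = m ∧ (∀ i < k, ∀ j < n, R i j ω = r i j) ∧ (∀ j < n, X j ω = x j))
      = pr p (fun ω => init ω = m)
        * (∏ i ∈ Finset.range k, ∏ j ∈ Finset.range n, pr p (fun ω => R i j ω = r i j))
        * pr p (fun ω => ∀ j < n, X j ω = x j)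

attribute [instance] Alg.fintS Alg.fintR

variable {Ω : Type} [Fintype Ω] {p : Ω → ℝ} {𝒳 : Type} [Fintype 𝒳] {n k : ℕ} {X : ℕ → Ω → 𝒳}

/-- Running pass `i` (0-indexed) of the algorithm for `j` steps starting from `ini`. -/
def Alg.runPass (M : Alg Ω p 𝒳 n k X) (i : ℕ) (ini : Ω → M.S) : ℕ → Ω → M.S
  | 0 => ini
  | j + 1 => fun ω =>
      if j < n ∧ i < k then
        M.f i j (X j ω) (M.runPass i ini j ω) (M.R i j ω)
      else M.runPass i ini j ω

/-- `M.passEnd i` is the memory state at the end of pass `i`; `M.passEnd 0 = M₀` is the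
initial state, and `M.passEnd i` is the paper's `M_i = M_{(i,n)}`. -/
def Alg.passEnd (M : Alg Ω p 𝒳 n k X) : ℕ → Ω → M.S
  | 0 => M.init
  | i + 1 => M.runPass i (M.passEnd i) n

/-- `M.st i j` is the memory state after reading `j` elements in pass `i+1`;
it is the paper's `M_{(i+1, j)}`. -/
def Alg.st (M : Alg Ω p 𝒳 n k X) (i j : ℕ) : Ω → M.S :=
  M.runPass i (M.passEnd i) j

/-- The multi-pass information cost
`MIC(M, μ) = Σ_{i=1}^{k} Σ_{j=1}^{n} Σ_{ℓ=1}^{j} I(M_{(i,j)}; X_ℓ | M_{(≤i,ℓ-1)}, M_{(≤i-1,j)})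
  + Σ_{i=1}^{k} Σ_{j=1}^{n} Σ_{ℓ=j+1}^{n} I(M_{(i,j)}; X_ℓ | M_{(≤i-1,ℓ-1)}, M_{(≤i-1,j)})`
(all summation indices below are 0-indexed shifts of the paper's 1-indexed ones). -/
def Alg.MIC (M : Alg Ω p 𝒳 n k X) : ℝ :=
  (∑ i ∈ Finset.range k, ∑ j ∈ Finset.range n, ∑ l ∈ Finset.range (j + 1),
    condMI p (M.st i (j + 1)) (X l)
      (fun ω => ((fun r : Fin (i + 1) => M.st r.1 l ω),
                 (fun r : Fin i => M.st r.1 (j + 1) ω))))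
  + (∑ i ∈ Finset.range k, ∑ j ∈ Finset.range n, ∑ l ∈ Finset.Ico (j + 1) n,
    condMI p (M.st i (j + 1)) (X l)
      (fun ω => ((fun r : Fin i => M.st r.1 l ω),
                 (fun r : Fin i => M.st r.1 (j + 1) ω))))

/-- The conditional information cost
`MIC_cond(M, μ) = Σ_{j=1}^{n} Σ_{ℓ=1}^{j} I(M_{(≤k,j)}; X_ℓ | M_{<k}, M_{(≤k,ℓ-1)})`. -/
def Alg.MICcond (M : Alg Ω p 𝒳 n k X) : ℝ :=
  ∑ j ∈ Finset.range n, ∑ l ∈ Finset.range (j + 1),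
    condMI p (fun ω => fun r : Fin k => M.st r.1 (j + 1) ω) (X l)
      (fun ω => ((fun r : Fin k => M.passEnd r.1 ω),
                 (fun r : Fin k => M.st r.1 l ω)))

end MultiPassIC

namespace MultiPassIC

section Entropy

variable {Ω : Type} [Fintype Ω] {p : Ω → ℝ}
variable {α β γ δ : Type} [Fintype α] [Fintype β] [Fintype γ] [Fintype δ]

theorem pr_congr {E F : Ω → Prop} (h : ∀ ω, E ω ↔ F ω) : pr p E = pr p F := by
  rw [show E = F from funext fun ω => propext (h ω)]

theorem IsPMF.pr_nonneg (hp : IsPMF p) (E : Ω → Prop) : 0 ≤ pr p E :=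
  Finset.sum_nonneg fun ω _ => by split_ifs <;> simp [hp.nonneg ω]

theorem IsPMF.pr_mono (hp : IsPMF p) {E F : Ω → Prop} (h : ∀ ω, E ω → F ω) :
    pr p E ≤ pr p F :=
  Finset.sum_le_sum fun ω _ => by
    by_cases hE : E ω
    · simp [hE, h ω hE]
    · rw [if_neg hE]; split_ifs <;> simp [hp.nonneg ω]

theorem IsPMF.pr_pos (hp : IsPMF p) {E : Ω → Prop} {ω : Ω} (hω : E ω) (h : p ω ≠ 0) :
    0 < pr p E := by
  refine Finset.sum_pos' (fun ω _ => by split_ifs <;> simp [hp.nonneg ω]) ⟨ω, mem_univ _, ?_⟩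
  rw [if_pos hω]
  exact lt_of_le_of_ne (hp.nonneg ω) (Ne.symm h)

/-- Law of the unconscious statistician. -/
theorem sum_pr_mul (A : Ω → α) (φ : α → ℝ) :
    ∑ a, pr p (fun ω => A ω = a) * φ a = ∑ ω, p ω * φ (A ω) := by
  simp only [pr, Finset.sum_mul, ite_mul, zero_mul]
  rw [Finset.sum_comm]
  simp

theorem sum_pr_and (A : Ω → α) (E : Ω → Prop) :
    ∑ a, pr p (fun ω => A ω = a ∧ E ω) = pr p E := by
  simp only [pr]
  rw [Finset.sum_comm]
  refine Finset.sum_congr rfl fun ω _ => ?_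
  by_cases h : E ω <;> simp [h]

theorem sum_pr (A : Ω → α) : ∑ a, pr p (fun ω => A ω = a) = ∑ ω, p ω := by
  simpa using sum_pr_mul (p := p) A (fun _ => 1)

theorem H_eq_sum (A : Ω → α) :
    H p A = -∑ ω, p ω * Real.logb 2 (pr p (fun ω' => A ω' = A ω)) := by
  rw [H, sum_pr_mul A (fun a => Real.logb 2 (pr p (fun ω => A ω = a)))]

theorem sum_pr_mul_three (A : Ω → α) (B : Ω → β) (C : Ω → γ) (φ : α → β → γ → ℝ) :
    ∑ a, ∑ b, ∑ c, pr p (fun ω => A ω = a ∧ B ω = b ∧ C ω = c) * φ a b c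
      = ∑ ω, p ω * φ (A ω) (B ω) (C ω) := by
  have := sum_pr_mul (p := p) (fun ω => (A ω, B ω, C ω)) (fun t => φ t.1 t.2.1 t.2.2)
  simpa only [Fintype.sum_prod_type, Prod.mk.injEq] using this

/-- `A` determines `B`: the random variable `B` is a function of `A`. -/
def Det {Ω α β : Type} (A : Ω → α) (B : Ω → β) : Prop := ∀ ω ω', A ω = A ω' → B ω = B ω'

section Det

variable {Ω α β γ : Type} {A : Ω → α} {B : Ω → β} {C : Ω → γ}

theorem Det.rfl : Det A A := fun _ _ h => h

theorem Det.trans (h : Det A B) (h' : Det B C) : Det A C := fun ω ω' e => h' ω ω' (h ω ω' e)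

theorem Det.fst : Det (fun ω => (A ω, B ω)) A := fun _ _ h => congrArg Prod.fst h

theorem Det.snd : Det (fun ω => (A ω, B ω)) B := fun _ _ h => congrArg Prod.snd h

theorem Det.pair (h : Det A B) (h' : Det A C) : Det A (fun ω => (B ω, C ω)) :=
  fun ω ω' e => Prod.ext (h ω ω' e) (h' ω ω' e)

theorem Det.pi {ι : Type} {D : ι → Ω → β} (h : ∀ r, Det A (D r)) : Det A (fun ω r => D r ω) :=
  fun ω ω' e => funext fun r => h r ω ω' e

theorem Det.apply {ι : Type} {D : ι → Ω → β} (r : ι) : Det (fun ω r => D r ω) (D r) :=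
  fun _ _ h => congrFun h r

theorem Det.pi_fin {r : ℕ} {D : ℕ → Ω → β} (h : ∀ q < r, Det A (D q)) :
    Det A (fun ω (q : Fin r) => D q.1 ω) :=
  Det.pi fun q => h q.1 q.2

theorem Det.apply_fin {r q : ℕ} (h : q < r) (D : ℕ → Ω → β) :
    Det (fun ω (q : Fin r) => D q.1 ω) (D q) :=
  Det.apply (D := fun q : Fin r => D q.1) ⟨q, h⟩

end Det

theorem H_congr {A : Ω → α} {B : Ω → β} (h : Det A B) (h' : Det B A) : H p A = H p B := by
  rw [H_eq_sum, H_eq_sum]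
  congr 1
  refine Finset.sum_congr rfl fun ω _ => ?_
  rw [pr_congr fun ω' => ⟨h ω' ω, h' ω' ω⟩]

theorem IsPMF.H_mono (hp : IsPMF p) {A : Ω → α} {B : Ω → β} (h : Det A B) : H p B ≤ H p A := by
  rw [H_eq_sum, H_eq_sum]
  refine neg_le_neg (Finset.sum_le_sum fun ω _ => ?_)
  by_cases h0 : p ω = 0
  · simp [h0]
  · exact mul_le_mul_of_nonneg_left (Real.logb_le_logb_of_le (by norm_num)
      (hp.pr_pos rfl h0) (hp.pr_mono fun ω' => h ω' ω)) (hp.nonneg ω)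

theorem IsPMF.condMI_eq (hp : IsPMF p) (A : Ω → α) (B : Ω → β) (C : Ω → γ) :
    condMI p A B C = H p (fun ω => (A ω, C ω)) + H p (fun ω => (B ω, C ω))
      - H p (fun ω => (A ω, B ω, C ω)) - H p C := by
  rw [condMI, sum_pr_mul_three A B C (fun a b c => Real.logb 2
    ((pr p (fun ω => C ω = c) * pr p (fun ω => A ω = a ∧ B ω = b ∧ C ω = c)) /
        (pr p (fun ω => A ω = a ∧ C ω = c) * pr p (fun ω => B ω = b ∧ C ω = c))))]
  simp only [H_eq_sum, Prod.mk.injEq]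
  rw [← sub_eq_zero]
  simp only [← Finset.sum_neg_distrib, ← Finset.sum_add_distrib, ← Finset.sum_sub_distrib]
  refine Finset.sum_eq_zero fun ω _ => ?_
  by_cases h0 : p ω = 0
  · simp [h0]
  have h1 : pr p (fun ω' => C ω' = C ω) ≠ 0 := (hp.pr_pos (E := fun ω' => C ω' = C ω) rfl h0).ne'
  have h2 : pr p (fun ω' => A ω' = A ω ∧ B ω' = B ω ∧ C ω' = C ω) ≠ 0 :=
    (hp.pr_pos ⟨rfl, rfl, rfl⟩ h0).ne'
  have h3 : pr p (fun ω' => A ω' = A ω ∧ C ω' = C ω) ≠ 0 := (hp.pr_pos ⟨rfl, rfl⟩ h0).ne'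
  have h4 : pr p (fun ω' => B ω' = B ω ∧ C ω' = C ω) ≠ 0 := (hp.pr_pos ⟨rfl, rfl⟩ h0).ne'
  rw [Real.logb_div (mul_ne_zero h1 h2) (mul_ne_zero h3 h4), Real.logb_mul h1 h2,
    Real.logb_mul h3 h4]
  ring

theorem logb_two_le {x : ℝ} (hx : 0 < x) : Real.logb 2 x ≤ (x - 1) / Real.log 2 :=
  div_le_div_of_nonneg_right (Real.log_le_sub_one_of_pos hx) (Real.log_nonneg (by norm_num))

theorem IsPMF.condMI_nonneg (hp : IsPMF p) (A : Ω → α) (B : Ω → β) (C : Ω → γ) :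
    0 ≤ condMI p A B C := by
  have hlog : 0 < Real.log 2 := Real.log_pos (by norm_num)
  have key : ∀ a b c, (pr p (fun ω => A ω = a ∧ B ω = b ∧ C ω = c)
        - pr p (fun ω => A ω = a ∧ C ω = c) * pr p (fun ω => B ω = b ∧ C ω = c)
          / pr p (fun ω => C ω = c)) / Real.log 2 ≤
      pr p (fun ω => A ω = a ∧ B ω = b ∧ C ω = c) *
      Real.logb 2 ((pr p (fun ω => C ω = c) *
          pr p (fun ω => A ω = a ∧ B ω = b ∧ C ω = c)) /
        (pr p (fun ω => A ω = a ∧ C ω = c) * pr p (fun ω => B ω = b ∧ C ω = c))) := by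
    intro a b c
    have hle1 : pr p (fun ω => A ω = a ∧ B ω = b ∧ C ω = c) ≤ pr p (fun ω => A ω = a ∧ C ω = c) :=
      hp.pr_mono fun ω h => ⟨h.1, h.2.2⟩
    have hle2 : pr p (fun ω => A ω = a ∧ B ω = b ∧ C ω = c) ≤ pr p (fun ω => B ω = b ∧ C ω = c) :=
      hp.pr_mono fun ω h => h.2
    have hle3 : pr p (fun ω => B ω = b ∧ C ω = c) ≤ pr p (fun ω => C ω = c) :=
      hp.pr_mono fun ω h => h.2
    have h0 := hp.pr_nonneg (fun ω => A ω = a ∧ B ω = b ∧ C ω = c)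
    generalize pr p (fun ω => A ω = a ∧ B ω = b ∧ C ω = c) = x at *
    generalize pr p (fun ω => A ω = a ∧ C ω = c) = y at *
    generalize pr p (fun ω => B ω = b ∧ C ω = c) = z at *
    generalize pr p (fun ω => C ω = c) = w at *
    rcases h0.eq_or_lt with h0 | h0
    · subst h0
      simp only [zero_mul, zero_sub]
      refine div_nonpos_of_nonpos_of_nonneg (neg_nonpos.2 ?_) hlog.le
      have := hle2.trans hle3
      positivity
    · have hy : 0 < y := h0.trans_le hle1
      have hz : 0 < z := h0.trans_le hle2
      have hw : 0 < w := hz.trans_le hle3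
      have := logb_two_le (x := y * z / (w * x)) (by positivity)
      rw [← inv_div (w * x), Real.logb_inv, inv_div] at this
      have := mul_le_mul_of_nonneg_left this h0.le
      have e : x * ((y * z / (w * x) - 1) / Real.log 2) = -((x - y * z / w) / Real.log 2) := by
        field_simp
        ring
      linarith
  have hsum : ∑ a, ∑ b, ∑ c, (pr p (fun ω => A ω = a ∧ B ω = b ∧ C ω = c)
        - pr p (fun ω => A ω = a ∧ C ω = c) * pr p (fun ω => B ω = b ∧ C ω = c)
          / pr p (fun ω => C ω = c)) / Real.log 2 = 0 := by
    simp only [← Finset.sum_div, Finset.sum_sub_distrib]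
    rw [div_eq_zero_iff]
    left
    rw [sub_eq_zero]
    trans ∑ c, pr p (fun ω => C ω = c)
    · have := sum_pr_mul_three (p := p) A B C (fun _ _ _ => 1)
      simp only [mul_one] at this
      rw [this, sum_pr]
    · symm
      simp only [div_eq_mul_inv]
      rw [Finset.sum_congr rfl fun a _ => Finset.sum_comm, Finset.sum_comm]
      refine Finset.sum_congr rfl fun c _ => ?_
      simp only [← Finset.sum_mul, ← Finset.mul_sum, sum_pr_and]
      by_cases h : pr p (fun ω => C ω = c) = 0 <;> simp [h]
  rw [← hsum]
  exact Finset.sum_le_sum fun a _ => Finset.sum_le_sum fun b _ => Finset.sum_le_sum fun c _ =>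
    key a b c

theorem IsPMF.H_le_logb_card (hp : IsPMF p) (A : Ω → α) :
    H p A ≤ Real.logb 2 (Fintype.card α) := by
  have hlog : 0 < Real.log 2 := Real.log_pos (by norm_num)
  have hne : Nonempty Ω := by
    by_contra h
    rw [not_nonempty_iff] at h
    simpa using hp.sum_one
  have hN : (0 : ℝ) < Fintype.card α := by
    exact_mod_cast Fintype.card_pos_iff.2 (hne.map A)
  have key : ∀ a, -(pr p (fun ω => A ω = a) * Real.logb 2 (pr p (fun ω => A ω = a)))
      ≤ pr p (fun ω => A ω = a) * Real.logb 2 (Fintype.card α)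
        + ((Fintype.card α : ℝ)⁻¹ - pr p (fun ω => A ω = a)) / Real.log 2 := by
    intro a
    have h0 := hp.pr_nonneg (fun ω => A ω = a)
    generalize pr p (fun ω => A ω = a) = x at *
    rcases h0.eq_or_lt with h0 | h0
    · subst h0
      simp only [zero_mul, neg_zero, sub_zero, zero_add]
      positivity
    · have := mul_le_mul_of_nonneg_left
        (logb_two_le (x := (Fintype.card α * x)⁻¹) (by positivity)) h0.le
      rw [Real.logb_inv, Real.logb_mul hN.ne' h0.ne'] at this
      have e : x * ((((Fintype.card α : ℝ) * x)⁻¹ - 1) / Real.log 2)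
          = ((Fintype.card α : ℝ)⁻¹ - x) / Real.log 2 := by
        field_simp
      linarith
  calc H p A = ∑ a, -(pr p (fun ω => A ω = a) * Real.logb 2 (pr p (fun ω => A ω = a))) := by
        rw [H, Finset.sum_neg_distrib]
    _ ≤ _ := Finset.sum_le_sum fun a _ => key a
    _ = Real.logb 2 (Fintype.card α) := by
        rw [Finset.sum_add_distrib, ← Finset.sum_mul, ← Finset.sum_div, Finset.sum_sub_distrib,
          sum_pr, hp.sum_one]
        simp [hN.ne']

theorem IsPMF.condMI_comm (hp : IsPMF p) (A : Ω → α) (B : Ω → β) (C : Ω → γ) :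
    condMI p A B C = condMI p B A C := by
  have : H p (fun ω => (A ω, B ω, C ω)) = H p (fun ω => (B ω, A ω, C ω)) :=
    H_congr (fun ω ω' h => by simp_all) (fun ω ω' h => by simp_all)
  rw [hp.condMI_eq, hp.condMI_eq, this]
  ring

theorem IsPMF.condMI_congr_left (hp : IsPMF p) {A : Ω → α} {A' : Ω → δ} {C : Ω → γ}
    (h : Det (fun ω => (A ω, C ω)) A') (h' : Det (fun ω => (A' ω, C ω)) A) (B : Ω → β) :
    condMI p A B C = condMI p A' B C := by
  have e1 : H p (fun ω => (A ω, C ω)) = H p (fun ω => (A' ω, C ω)) :=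
    H_congr (h.pair .snd) (h'.pair .snd)
  have e2 : H p (fun ω => (A ω, B ω, C ω)) = H p (fun ω => (A' ω, B ω, C ω)) :=
    H_congr (.pair ((Det.fst.pair (Det.snd.trans .snd)).trans h) .snd)
      (.pair ((Det.fst.pair (Det.snd.trans .snd)).trans h') .snd)
  rw [hp.condMI_eq, hp.condMI_eq, e1, e2]

theorem IsPMF.condMI_congr_cond (hp : IsPMF p) {C : Ω → γ} {C' : Ω → δ}
    (h : Det C C') (h' : Det C' C) (A : Ω → α) (B : Ω → β) :
    condMI p A B C = condMI p A B C' := by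
  have e1 : H p (fun ω => (A ω, C ω)) = H p (fun ω => (A ω, C' ω)) :=
    H_congr (Det.fst.pair (Det.snd.trans h)) (Det.fst.pair (Det.snd.trans h'))
  have e2 : H p (fun ω => (B ω, C ω)) = H p (fun ω => (B ω, C' ω)) :=
    H_congr (Det.fst.pair (Det.snd.trans h)) (Det.fst.pair (Det.snd.trans h'))
  have e3 : H p (fun ω => (A ω, B ω, C ω)) = H p (fun ω => (A ω, B ω, C' ω)) :=
    H_congr (Det.fst.pair ((Det.snd.trans .fst).pair ((Det.snd.trans .snd).trans h)))
      (Det.fst.pair ((Det.snd.trans .fst).pair ((Det.snd.trans .snd).trans h')))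
  rw [hp.condMI_eq, hp.condMI_eq, e1, e2, e3, H_congr h h']

/-- The chain rule for conditional mutual information. -/
theorem IsPMF.condMI_chain (hp : IsPMF p) (A : Ω → α) (A' : Ω → δ) (B : Ω → β) (C : Ω → γ) :
    condMI p (fun ω => (A ω, A' ω)) B C
      = condMI p A' B C + condMI p A B (fun ω => (A' ω, C ω)) := by
  have e1 : H p (fun ω => ((A ω, A' ω), C ω)) = H p (fun ω => (A ω, A' ω, C ω)) :=
    H_congr (fun ω ω' h => by simp only [Prod.mk.injEq] at h ⊢; tauto)
      (fun ω ω' h => by simp only [Prod.mk.injEq] at h ⊢; tauto)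
  have e2 : H p (fun ω => ((A ω, A' ω), B ω, C ω)) = H p (fun ω => (A ω, B ω, A' ω, C ω)) :=
    H_congr (fun ω ω' h => by simp only [Prod.mk.injEq] at h ⊢; tauto)
      (fun ω ω' h => by simp only [Prod.mk.injEq] at h ⊢; tauto)
  have e3 : H p (fun ω => (B ω, A' ω, C ω)) = H p (fun ω => (A' ω, B ω, C ω)) :=
    H_congr (fun ω ω' h => by simp only [Prod.mk.injEq] at h ⊢; tauto)
      (fun ω ω' h => by simp only [Prod.mk.injEq] at h ⊢; tauto)
  rw [hp.condMI_eq, hp.condMI_eq, hp.condMI_eq, e1, e2, e3]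
  ring

theorem IsPMF.condMI_mono_left (hp : IsPMF p) {A : Ω → α} {A' : Ω → δ} {C : Ω → γ}
    (h : Det (fun ω => (A' ω, C ω)) A) (B : Ω → β) :
    condMI p A B C ≤ condMI p A' B C := by
  have e : condMI p A' B C = condMI p (fun ω => (A' ω, A ω)) B C :=
    hp.condMI_congr_left (Det.fst.pair h) (Det.fst.trans .fst) B
  rw [e, hp.condMI_chain]
  exact le_add_of_nonneg_right (hp.condMI_nonneg _ _ _)

theorem IsPMF.condMI_mono_right (hp : IsPMF p) {B : Ω → β} {B' : Ω → δ} {C : Ω → γ}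
    (h : Det (fun ω => (B' ω, C ω)) B) (A : Ω → α) :
    condMI p A B C ≤ condMI p A B' C := by
  rw [hp.condMI_comm A B, hp.condMI_comm A B']
  exact hp.condMI_mono_left h A

theorem IsPMF.condMI_eq_zero_of_det (hp : IsPMF p) {A : Ω → α} {C : Ω → γ} (h : Det C A)
    (B : Ω → β) : condMI p A B C = 0 := by
  have e1 : H p (fun ω => (A ω, C ω)) = H p C :=
    H_congr .snd (h.pair .rfl)
  have e2 : H p (fun ω => (A ω, B ω, C ω)) = H p (fun ω => (B ω, C ω)) :=
    H_congr .snd (.pair (Det.snd.trans h) .rfl)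
  rw [hp.condMI_eq, e1, e2]
  ring

/-- Functions of conditionally independent variables are conditionally independent. -/
theorem IsPMF.condMI_eq_zero_mono (hp : IsPMF p) {δ' : Type} [Fintype δ'] {A : Ω → α} {B : Ω → β}
    {C : Ω → γ} {A' : Ω → δ} {B' : Ω → δ'} (h : condMI p A B C = 0)
    (hA : Det (fun ω => (A ω, C ω)) A') (hB : Det (fun ω => (B ω, C ω)) B') :
    condMI p A' B' C = 0 :=
  le_antisymm (h ▸ (hp.condMI_mono_left hA B').trans (hp.condMI_mono_right hB A))
    (hp.condMI_nonneg _ _ _)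

/-- Conditional independence of `A` and `B` persists when a message computed by the holder of
`A` is appended to the conditioning. -/
theorem IsPMF.condMI_eq_zero_message (hp : IsPMF p) {A : Ω → α} {B : Ω → β} {C : Ω → γ}
    {C' : Ω → δ} (h : condMI p A B C = 0) (hC' : Det (fun ω => (A ω, C ω)) C') (hC : Det C' C) :
    condMI p A B C' = 0 := by
  have h1 : condMI p (fun ω => (A ω, C' ω)) B C = 0 :=
    hp.condMI_eq_zero_mono h (Det.fst.pair hC') .fst
  rw [hp.condMI_chain, ← hp.condMI_congr_cond (Det.rfl.pair hC) Det.fst] at h1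
  have := hp.condMI_nonneg C' B C
  have := hp.condMI_nonneg A B C'
  linarith

theorem IsPMF.condMI_le_add_cond (hp : IsPMF p) {A : Ω → α} {B : Ω → β} {C : Ω → γ} {D : Ω → δ}
    (h : condMI p D B C = 0) : condMI p A B C ≤ condMI p A B (fun ω => (D ω, C ω)) := by
  have := hp.condMI_chain A D B C
  have h2 : condMI p A B C ≤ condMI p (fun ω => (A ω, D ω)) B C :=
    hp.condMI_mono_left (Det.fst.trans .fst) B
  linarith

theorem IsPMF.condMI_le_H (hp : IsPMF p) (A : Ω → α) (B : Ω → β) (C : Ω → γ) :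
    condMI p A B C ≤ H p A := by
  have h0 := hp.condMI_nonneg A C (fun _ => ())
  have e1 : H p (fun ω => (A ω, ())) = H p A :=
    H_congr (fun ω ω' h => by simp_all) (fun ω ω' h => by simp_all)
  have e2 : H p (fun ω => (C ω, ())) = H p C :=
    H_congr (fun ω ω' h => by simp_all) (fun ω ω' h => by simp_all)
  have e3 : H p (fun ω => (A ω, C ω, ())) = H p (fun ω => (A ω, C ω)) :=
    H_congr (fun ω ω' h => by simp_all) (fun ω ω' h => by simp_all)
  have e4 : H p (fun _ : Ω => ()) = 0 := by
    simp [H, pr, hp.sum_one]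
  have h1 : H p (fun ω => (B ω, C ω)) ≤ H p (fun ω => (A ω, B ω, C ω)) :=
    hp.H_mono .snd
  rw [hp.condMI_eq, e1, e2, e3, e4] at h0
  rw [hp.condMI_eq]
  linarith

/-- A factorization of the joint law yields conditional independence. -/
theorem condMI_eq_zero_of_factor {A : Ω → α} {B : Ω → β} {C : Ω → γ}
    (f : α → γ → ℝ) (g : β → γ → ℝ)
    (h : ∀ a b c, pr p (fun ω => A ω = a ∧ B ω = b ∧ C ω = c) = f a c * g b c) :
    condMI p A B C = 0 := by
  have hB : ∀ b c, pr p (fun ω => B ω = b ∧ C ω = c) = (∑ a, f a c) * g b c := fun b c => by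
    rw [← sum_pr_and A, Finset.sum_mul]
    exact Finset.sum_congr rfl fun a _ => h a b c
  have hA : ∀ a c, pr p (fun ω => A ω = a ∧ C ω = c) = f a c * ∑ b, g b c := fun a c => by
    rw [← sum_pr_and B, Finset.mul_sum]
    refine Finset.sum_congr rfl fun b _ => ?_
    rw [← h]
    exact pr_congr fun ω => by tauto
  have hC : ∀ c, pr p (fun ω => C ω = c) = (∑ a, f a c) * ∑ b, g b c := fun c => by
    rw [← sum_pr_and B, Finset.mul_sum]
    exact Finset.sum_congr rfl fun b _ => hB b c
  refine Finset.sum_eq_zero fun a _ => Finset.sum_eq_zero fun b _ =>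
    Finset.sum_eq_zero fun c _ => ?_
  rw [h, hA, hB, hC]
  by_cases h0 : (∑ a, f a c) * (∑ b, g b c) * (f a c * g b c) = 0
  · simp [h0]
  · rw [show f a c * (∑ b, g b c) * ((∑ a, f a c) * g b c)
      = (∑ a, f a c) * (∑ b, g b c) * (f a c * g b c) by ring, div_self h0]
    simp

end Entropy

section Protocol

variable {Ω : Type} [Fintype Ω] {p : Ω → ℝ} {𝒳 : Type} [Fintype 𝒳] {n k : ℕ} {X : ℕ → Ω → 𝒳}

/-- The input elements at the positions in `J`, together with the randomness that all passes
use there. -/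
def Alg.cols (M : Alg Ω p 𝒳 n k X) (J : Set ℕ) :
    Ω → ({m : Fin n // m.1 ∈ J} → 𝒳 × (Fin k → M.Rv)) :=
  fun ω m => (X m.1.1 ω, fun i => M.R i.1 m.1.1 ω)

/-- The initial state together with the columns outside `J`. -/
def Alg.rest (M : Alg Ω p 𝒳 n k X) (J : Set ℕ) :
    Ω → M.S × ({m : Fin n // m.1 ∈ Jᶜ} → 𝒳 × (Fin k → M.Rv)) :=
  fun ω => (M.init ω, M.cols Jᶜ ω)

/-- The positions `l, …, j - 1`. -/
def segment (l j : ℕ) : Set ℕ := {m | l ≤ m ∧ m < j}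

/-- The states of the first `a` passes at position `l` and of the first `b` passes at
position `j`. -/
def Alg.transcript (M : Alg Ω p 𝒳 n k X) (l j a b : ℕ) : Ω → (Fin a → M.S) × (Fin b → M.S) :=
  fun ω => ((fun r : Fin a => M.st r.1 l ω), (fun r : Fin b => M.st r.1 j ω))

theorem Alg.condMI_cols_rest (M : Alg Ω p 𝒳 n k X) (hp : IsPMF p) (hprod : IsProduct p n X)
    (J : Set ℕ) : condMI p (M.cols J) (M.rest J) (fun _ => ()) = 0 := by
  obtain ⟨ω₀⟩ : Nonempty Ω := by
    by_contra h
    rw [not_nonempty_iff] at h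
    simpa using hp.sum_one
  let Q : Fin n → 𝒳 × (Fin k → M.Rv) → ℝ := fun m z =>
    pr p (fun ω => X m.1 ω = z.1) * ∏ i : Fin k, pr p (fun ω => M.R i.1 m.1 ω = z.2 i)
  refine condMI_eq_zero_of_factor
    (fun a _ => ∏ m : Fin n, if h : m.1 ∈ J then Q m (a ⟨m, h⟩) else 1)
    (fun b _ => pr p (fun ω => M.init ω = b.1) *
      ∏ m : Fin n, if h : m.1 ∈ J then 1 else Q m (b.2 ⟨m, h⟩)) fun a b c => ?_
  let z : Fin n → 𝒳 × (Fin k → M.Rv) := fun m =>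
    if h : m.1 ∈ J then a ⟨m, h⟩ else b.2 ⟨m, h⟩
  let x : ℕ → 𝒳 := fun j => if h : j < n then (z ⟨j, h⟩).1 else X j ω₀
  let r : ℕ → ℕ → M.Rv := fun i j =>
    if h : j < n ∧ i < k then (z ⟨j, h.1⟩).2 ⟨i, h.2⟩ else M.R i j ω₀
  have hx : ∀ m : Fin n, x m.1 = (z m).1 := fun m => dif_pos m.2
  have hr : ∀ (i : Fin k) (m : Fin n), r i.1 m.1 = (z m).2 i := fun i m => dif_pos ⟨m.2, i.2⟩
  have hev : ∀ ω, (M.cols J ω = a ∧ M.rest J ω = b ∧ () = c) ↔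
      (M.init ω = b.1 ∧ (∀ i < k, ∀ j < n, M.R i j ω = r i j) ∧ (∀ j < n, X j ω = x j)) := by
    intro ω
    have h1 : (∀ m : Fin n, (X m.1 ω, fun i : Fin k => M.R i.1 m.1 ω) = z m) ↔
        ((∀ i < k, ∀ j < n, M.R i j ω = r i j) ∧ (∀ j < n, X j ω = x j)) := by
      constructor
      · intro h
        refine ⟨fun i hi j hj => ?_, fun j hj => ?_⟩
        · rw [hr ⟨i, hi⟩ ⟨j, hj⟩, ← h]
        · rw [hx ⟨j, hj⟩, ← h]
      · rintro ⟨h, h'⟩ m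
        refine Prod.ext ?_ (funext fun i => ?_)
        · rw [← hx]; exact h' m.1 m.2
        · rw [← hr]; exact h i.1 i.2 m.1 m.2
    have h2 : (M.cols J ω = a ∧ M.cols Jᶜ ω = b.2) ↔
        ∀ m : Fin n, (X m.1 ω, fun i : Fin k => M.R i.1 m.1 ω) = z m := by
      constructor
      · rintro ⟨h, h'⟩ m
        by_cases hm : m.1 ∈ J
        · simp only [z, dif_pos hm, ← h, Alg.cols]
        · simp only [z, dif_neg hm, ← h', Alg.cols]
      · intro h
        refine ⟨funext fun m => ?_, funext fun m => ?_⟩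
        · exact (h m.1).trans (dif_pos m.2)
        · exact (h m.1).trans (dif_neg m.2)
    rw [← h1, ← h2, Alg.rest, Prod.ext_iff]
    simp only [and_true]
    tauto
  rw [pr_congr hev, M.indep, hprod, Finset.prod_comm]
  have hQ : (∏ j ∈ Finset.range n, ∏ i ∈ Finset.range k, pr p (fun ω => M.R i j ω = r i j)) *
      ∏ j ∈ Finset.range n, pr p (fun ω => X j ω = x j) = ∏ m : Fin n, Q m (z m) := by
    rw [← Finset.prod_mul_distrib, Finset.prod_range]
    refine Finset.prod_congr rfl fun m _ => ?_
    rw [Finset.prod_range, mul_comm]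
    simp only [hx, hr, Q]
  have hsplit : ∏ m : Fin n, Q m (z m) =
      (∏ m : Fin n, if h : m.1 ∈ J then Q m (a ⟨m, h⟩) else 1) *
        ∏ m : Fin n, if h : m.1 ∈ J then 1 else Q m (b.2 ⟨m, h⟩) := by
    rw [← Finset.prod_mul_distrib]
    refine Finset.prod_congr rfl fun m _ => ?_
    by_cases hm : m.1 ∈ J <;> simp [z, hm]
  rw [mul_assoc, hQ, hsplit]
  ring

variable {α : Type} {D : Ω → α} {l j : ℕ}

theorem Alg.det_cols_input (M : Alg Ω p 𝒳 n k X) {J : Set ℕ} {m : ℕ} (hm : m < n) (hJ : m ∈ J) :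
    Det (M.cols J) (X m) :=
  fun _ _ h => congrArg Prod.fst (congrFun h ⟨⟨m, hm⟩, hJ⟩)

theorem Alg.det_cols_rand (M : Alg Ω p 𝒳 n k X) {J : Set ℕ} {m i : ℕ} (hm : m < n) (hi : i < k)
    (hJ : m ∈ J) : Det (M.cols J) (M.R i m) :=
  fun _ _ h => congrFun (congrArg Prod.snd (congrFun h ⟨⟨m, hm⟩, hJ⟩)) ⟨i, hi⟩

theorem Alg.det_st_succ (M : Alg Ω p 𝒳 n k X) {J : Set ℕ} {i m : ℕ} (hst : Det D (M.st i m))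
    (hD : Det D (M.cols J)) (hJ : m ∈ J) : Det D (M.st i (m + 1)) := by
  intro ω ω' h
  have hs := hst ω ω' h
  simp only [Alg.st] at hs
  simp only [Alg.st, Alg.runPass]
  split_ifs with hc
  · rw [hs, (hD.trans (M.det_cols_input hc.1 hJ)) ω ω' h,
      (hD.trans (M.det_cols_rand hc.1 hc.2 hJ)) ω ω' h]
  · exact hs

theorem Alg.det_st_of_le (M : Alg Ω p 𝒳 n k X) {J : Set ℕ} {i m m' : ℕ} (hm : m ≤ m')
    (hst : Det D (M.st i m)) (hD : Det D (M.cols J)) (hJ : ∀ q, m ≤ q → q < m' → q ∈ J) :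
    Det D (M.st i m') := by
  induction m', hm using Nat.le_induction with
  | base => exact hst
  | succ q hq ih =>
    exact M.det_st_succ (ih fun q' h h' => hJ q' h (by omega)) hD (hJ q hq (by omega))

theorem Alg.det_passEnd (M : Alg Ω p 𝒳 n k X) {r : ℕ} (hj : j ≤ n)
    (hD : Det D (M.rest (segment l j))) (hst : ∀ q < r, Det D (M.st q j)) :
    Det D (M.passEnd r) := by
  cases r with
  | zero => exact hD.trans .fst
  | succ r =>
    exact M.det_st_of_le hj (hst r (by omega)) (hD.trans .snd) fun q h _ h' => by
      have := h'.2
      omega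

theorem Alg.det_st_rest (M : Alg Ω p 𝒳 n k X) {r m : ℕ} (hj : j ≤ n) (hm : m ≤ l)
    (hD : Det D (M.rest (segment l j))) (hst : ∀ q < r, Det D (M.st q j)) :
    Det D (M.st r m) :=
  M.det_st_of_le (Nat.zero_le m) (M.det_passEnd hj hD hst) (hD.trans .snd) fun q _ h h' => by
    have := h'.1
    omega

theorem Alg.det_st_cols (M : Alg Ω p 𝒳 n k X) {r : ℕ} (hl : l ≤ j)
    (hD : Det D (M.cols (segment l j))) (hst : Det D (M.st r l)) : Det D (M.st r j) :=
  M.det_st_of_le hl hst hD fun _ h h' => ⟨h, h'⟩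

theorem Alg.det_transcript (M : Alg Ω p 𝒳 n k X) {a b : ℕ} (ha : ∀ q < a, Det D (M.st q l))
    (hb : ∀ q < b, Det D (M.st q j)) : Det D (M.transcript l j a b) :=
  (Det.pi_fin ha).pair (Det.pi_fin hb)

theorem Alg.transcript_det_left (M : Alg Ω p 𝒳 n k X) {a b q : ℕ} (hq : q < a) :
    Det (M.transcript l j a b) (M.st q l) :=
  Det.fst.trans (Det.apply_fin hq fun q => M.st q l)

theorem Alg.transcript_det_right (M : Alg Ω p 𝒳 n k X) {a b q : ℕ} (hq : q < b) :
    Det (M.transcript l j a b) (M.st q j) :=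
  Det.snd.trans (Det.apply_fin hq fun q => M.st q j)

theorem Alg.transcript_det_transcript (M : Alg Ω p 𝒳 n k X) {a b a' b' : ℕ} (ha : a ≤ a')
    (hb : b ≤ b') : Det (M.transcript l j a' b') (M.transcript l j a b) :=
  M.det_transcript (fun _ hq => M.transcript_det_left (by omega))
    (fun _ hq => M.transcript_det_right (by omega))

/-- If the segment `[l, j)` and the rest of the stream are independent given the first `r`
rounds, then they stay so when the holder of the rest sends its next message. -/
theorem Alg.condMI_transcript_succ_left (M : Alg Ω p 𝒳 n k X) (hp : IsPMF p) (hj : j ≤ n) {r : ℕ}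
    (h : condMI p (M.cols (segment l j)) (M.rest (segment l j)) (M.transcript l j r r) = 0) :
    condMI p (M.cols (segment l j)) (M.rest (segment l j)) (M.transcript l j (r + 1) r) = 0 := by
  rw [hp.condMI_comm] at h ⊢
  refine hp.condMI_eq_zero_message h (M.det_transcript (fun q hq => ?_) fun q hq => ?_)
    (M.transcript_det_transcript (by omega) le_rfl)
  · exact M.det_st_rest hj le_rfl .fst fun q' hq' =>
      Det.snd.trans (M.transcript_det_right (by omega))
  · exact Det.snd.trans (M.transcript_det_right hq)

/-- The segment `[l, j)` and the rest of the stream are independent given the states at which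
the passes enter and leave the segment. -/
theorem Alg.condMI_transcript (M : Alg Ω p 𝒳 n k X) (hp : IsPMF p) (hprod : IsProduct p n X)
    (hl : l ≤ j) (hj : j ≤ n) (r : ℕ) :
    condMI p (M.cols (segment l j)) (M.rest (segment l j)) (M.transcript l j r r) = 0 := by
  induction r with
  | zero =>
    exact hp.condMI_eq_zero_message (C := fun _ => ()) (M.condMI_cols_rest hp hprod _)
      (M.det_transcript (fun q hq => absurd hq q.not_lt_zero)
        fun q hq => absurd hq q.not_lt_zero) (fun _ _ _ => rfl)
  | succ r ih =>
    refine hp.condMI_eq_zero_message (M.condMI_transcript_succ_left hp hj ih)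
      (M.det_transcript (fun q hq => ?_) fun q hq => ?_)
      (M.transcript_det_transcript le_rfl (by omega))
    · exact Det.snd.trans (M.transcript_det_left hq)
    · exact M.det_st_cols hl .fst (Det.snd.trans (M.transcript_det_left hq))

/-- The information that the states around the segment `[l, j)` reveal about `X l` is revealed
by the states at its end. -/
theorem Alg.condMI_transcript_input_le (M : Alg Ω p 𝒳 n k X) (hp : IsPMF p)
    (hprod : IsProduct p n X) (hl : l < j) (hj : j ≤ n) (r : ℕ) :
    condMI p (M.transcript l j r r) (X l) (fun _ => ()) ≤
      ∑ i ∈ Finset.range r, condMI p (M.st i j) (X l) (M.transcript l j (i + 1) i) := by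
  induction r with
  | zero =>
    rw [Finset.sum_range_zero, hp.condMI_eq_zero_of_det
      (M.det_transcript (fun q hq => by omega) fun q hq => by omega)]
  | succ r ih =>
    have hcols : Det (M.cols (segment l j)) (X l) :=
      M.det_cols_input (by omega) ⟨le_rfl, hl⟩
    have hT : condMI p (M.st r l) (X l) (M.transcript l j r r) = 0 := by
      rw [hp.condMI_comm]
      exact hp.condMI_eq_zero_mono (M.condMI_transcript hp hprod hl.le hj r)
        (Det.fst.trans hcols)
        (M.det_st_rest hj le_rfl .fst fun q hq => Det.snd.trans (M.transcript_det_right hq))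
    have h1 : condMI p (M.transcript l j (r + 1) r) (X l) (fun _ => ()) =
        condMI p (M.transcript l j r r) (X l) (fun _ => ()) := by
      rw [hp.condMI_congr_left (A' := fun ω => (M.st r l ω, M.transcript l j r r ω))
        (Det.fst.trans ((M.transcript_det_left (by omega)).pair
          (M.transcript_det_transcript (by omega) le_rfl))) _ (X l), hp.condMI_chain,
        hp.condMI_congr_cond (C' := M.transcript l j r r) .fst (Det.rfl.pair fun _ _ _ => rfl), hT,
        add_zero]
      refine M.det_transcript (fun q hq => ?_) fun q hq => ?_
      · rcases Nat.lt_succ_iff_lt_or_eq.1 hq with hq | rfl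
        · exact Det.fst.trans (Det.snd.trans (M.transcript_det_left hq))
        · exact Det.fst.trans .fst
      · exact Det.fst.trans (Det.snd.trans (M.transcript_det_right hq))
    rw [Finset.sum_range_succ, hp.condMI_congr_left
      (A' := fun ω => (M.st r j ω, M.transcript l j (r + 1) r ω))
      (Det.fst.trans ((M.transcript_det_right (by omega)).pair
        (M.transcript_det_transcript le_rfl (by omega)))) _ (X l), hp.condMI_chain, h1,
      hp.condMI_congr_cond (C' := M.transcript l j (r + 1) r) .fst (Det.rfl.pair fun _ _ _ => rfl)]
    · exact add_le_add_left ih _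
    · refine M.det_transcript (fun q hq => ?_) fun q hq => ?_
      · exact Det.fst.trans (Det.snd.trans (M.transcript_det_left hq))
      · rcases Nat.lt_succ_iff_lt_or_eq.1 hq with hq | rfl
        · exact Det.fst.trans (Det.snd.trans (M.transcript_det_right hq))
        · exact Det.fst.trans .fst

/-- The information about `X l` in the states at the end of the segment `[l, j)`, given the
states at its start and between the passes, is bounded pass by pass. -/
theorem Alg.condMI_given_passEnd_le (M : Alg Ω p 𝒳 n k X) (hp : IsPMF p)
    (hprod : IsProduct p n X) (hl : l < j) (hj : j ≤ n) :
    condMI p (fun ω => fun r : Fin k => M.st r.1 j ω) (X l)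
      (fun ω => ((fun r : Fin k => M.passEnd r.1 ω), (fun r : Fin k => M.st r.1 l ω))) ≤
      ∑ i ∈ Finset.range k, condMI p (M.st i j) (X l) (M.transcript l j (i + 1) i) := by
  set U : Ω → Fin k → M.S := fun ω r => M.st r.1 j ω
  set E : Ω → Fin k → M.S := fun ω r => M.passEnd r.1 ω
  set T : Ω → Fin k → M.S := fun ω r => M.st r.1 l ω
  have hcond : condMI p U (X l) (fun ω => (E ω, T ω)) ≤
      condMI p (fun ω => (U ω, (E ω, T ω))) (X l) (fun _ => ()) := by
    rw [hp.condMI_chain, hp.condMI_congr_cond (C := fun ω => ((E ω, T ω), ()))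
      (C' := fun ω => (E ω, T ω)) .fst (Det.rfl.pair fun _ _ _ => rfl)]
    exact le_add_of_nonneg_left (hp.condMI_nonneg _ _ _)
  have hmono : condMI p (fun ω => (U ω, (E ω, T ω))) (X l) (fun _ => ()) ≤
      condMI p (fun ω => (E ω, M.transcript l j k k ω)) (X l) (fun _ => ()) :=
    hp.condMI_mono_left (Det.fst.trans
      ((Det.snd.trans .snd).pair (Det.fst.pair (Det.snd.trans .fst)))) _
  have hzero : condMI p E (X l) (fun ω => (M.transcript l j k k ω, ())) = 0 := by
    rw [hp.condMI_congr_cond (C' := M.transcript l j k k) .fst (Det.rfl.pair fun _ _ _ => rfl),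
      hp.condMI_comm]
    refine hp.condMI_eq_zero_mono (M.condMI_transcript hp hprod hl.le hj k)
      (Det.fst.trans (M.det_cols_input (by omega) ⟨le_rfl, hl⟩)) (Det.pi fun r => ?_)
    exact M.det_passEnd hj .fst fun q hq =>
      Det.snd.trans (M.transcript_det_right (by have := r.2; omega))
  rw [hp.condMI_chain E, hzero, add_zero] at hmono
  exact (hcond.trans hmono).trans (M.condMI_transcript_input_le hp hprod hl hj k)

/-- The states of the first `r` passes at the positions `0, …, l` and the first `l` inputs. -/
def Alg.history (M : Alg Ω p 𝒳 n k X) (r l : ℕ) :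
    Ω → (Fin (l + 1) → Fin r → M.S) × (Fin l → 𝒳) :=
  fun ω => ((fun m q => M.st q.1 m.1 ω), fun m => X m.1 ω)

theorem Alg.det_history (M : Alg Ω p 𝒳 n k X) {r : ℕ}
    (hst : ∀ m ≤ l, ∀ q < r, Det D (M.st q m)) (hX : ∀ m < l, Det D (X m)) :
    Det D (M.history r l) :=
  Det.pair (Det.pi_fin (D := fun m ω (q : Fin r) => M.st q.1 m ω) fun m hm =>
    Det.pi_fin (hst m (by omega))) (Det.pi_fin hX)

theorem Alg.history_det_st (M : Alg Ω p 𝒳 n k X) {r m q : ℕ} (hm : m ≤ l) (hq : q < r) :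
    Det (M.history r l) (M.st q m) :=
  (Det.fst.trans (Det.apply_fin (D := fun m ω (q : Fin r) => M.st q.1 m ω)
    (Nat.lt_succ_of_le hm))).trans (Det.apply_fin hq fun q => M.st q m)

theorem Alg.history_det_input (M : Alg Ω p 𝒳 n k X) {r m : ℕ} (hm : m < l) :
    Det (M.history r l) (X m) :=
  Det.snd.trans (Det.apply_fin hm X)

/-- Conditioning on the whole history before position `l` only increases the information that
pass `i` has about `X l` at position `j`. -/
theorem Alg.condMI_le_condMI_history (M : Alg Ω p 𝒳 n k X) (hp : IsPMF p)
    (hprod : IsProduct p n X) (hl : l < j) (hj : j ≤ n) (i : ℕ) :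
    condMI p (M.st i j) (X l) (M.transcript l j (i + 1) i) ≤
      condMI p (M.st i j) (X l)
        (fun ω => (M.history (i + 1) l ω, fun r : Fin i => M.st r.1 j ω)) := by
  have hzero : condMI p (M.history (i + 1) l) (X l) (M.transcript l j (i + 1) i) = 0 := by
    rw [hp.condMI_comm]
    refine hp.condMI_eq_zero_mono
      (M.condMI_transcript_succ_left hp hj (M.condMI_transcript hp hprod hl.le hj i))
      (Det.fst.trans (M.det_cols_input (by omega) ⟨le_rfl, hl⟩))
      (M.det_history (fun m hm q hq => ?_) fun m hm => ?_)
    · exact M.det_st_rest hj hm .fst fun q' hq' =>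
        Det.snd.trans (M.transcript_det_right (by omega))
    · refine Det.fst.trans (Det.snd.trans (M.det_cols_input (by omega) fun h => ?_))
      have := h.1
      omega
  refine (hp.condMI_le_add_cond hzero).trans (hp.condMI_congr_cond ?_ ?_ _ _).le
  · exact Det.fst.pair (Det.snd.trans .snd)
  · exact Det.fst.pair (M.det_transcript
      (fun q hq => Det.fst.trans (M.history_det_st le_rfl hq))
      fun q hq => Det.snd.trans (Det.apply_fin hq fun q => M.st q j))

theorem Alg.sum_condMI_le_condMI_history (M : Alg Ω p 𝒳 n k X) (hp : IsPMF p)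
    (hprod : IsProduct p n X) (hj : j ≤ n) (i : ℕ) (hl : l ≤ j) :
    ∑ m ∈ Finset.range l, condMI p (M.st i j) (X m) (M.transcript m j (i + 1) i) ≤
      condMI p (M.st i j) (M.history (i + 1) l) (fun ω => fun r : Fin i => M.st r.1 j ω) := by
  induction l with
  | zero =>
    rw [Finset.sum_range_zero]
    exact hp.condMI_nonneg _ _ _
  | succ l ih =>
    rw [Finset.sum_range_succ]
    refine (add_le_add (ih (by omega)) (M.condMI_le_condMI_history hp hprod hl hj i)).trans ?_
    rw [hp.condMI_comm _ (M.history _ _), hp.condMI_comm _ (X l), ← hp.condMI_chain,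
      hp.condMI_comm _ (M.history _ _)]
    refine hp.condMI_mono_left (Det.fst.trans (.pair (M.history_det_input (by omega)) ?_)) _
    exact M.det_history (fun m hm q hq => M.history_det_st (by omega) hq)
      fun m hm => M.history_det_input (by omega)

/-- For each pass and position, the information about the inputs read so far is at most the
logarithm of the number of memory states. -/
theorem Alg.sum_condMI_le_logb_card (M : Alg Ω p 𝒳 n k X) (hp : IsPMF p)
    (hprod : IsProduct p n X) (hj : j ≤ n) (i : ℕ) :
    ∑ l ∈ Finset.range j, condMI p (M.st i j) (X l) (M.transcript l j (i + 1) i) ≤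
      Real.logb 2 (Fintype.card M.S) :=
  (M.sum_condMI_le_condMI_history hp hprod hj i le_rfl).trans
    ((hp.condMI_le_H _ _ _).trans (hp.H_le_logb_card _))

end Protocol

/-- Lemma `upperboundofmic'`: if `(X_1, …, X_n)` is drawn from a product
distribution `μ`, then for any `k`-pass streaming algorithm `M`,
`MIC(M,μ) ≥ Σ_{i=1}^{k} Σ_{j=1}^{n} Σ_{ℓ=1}^{j} I(M_{(i,j)}; X_ℓ | M_{(≤i,ℓ-1)}, M_{(≤i-1,j)})
 ≥ MIC_cond(M,μ)`; consequently if `M` uses `s` bits of memory then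
`MIC_cond(M,μ) ≤ k·s·n`. -/
theorem mic_ge_miccond
    {Ω : Type} [Fintype Ω] {p : Ω → ℝ} {𝒳 : Type} [Fintype 𝒳] {n k s : ℕ}
    {X : ℕ → Ω → 𝒳}
    (hp : IsPMF p) (hprod : IsProduct p n X)
    (M : Alg Ω p 𝒳 n k X) :
    ((∑ i ∈ Finset.range k, ∑ j ∈ Finset.range n, ∑ l ∈ Finset.range (j + 1),
        condMI p (M.st i (j + 1)) (X l)
          (fun ω => ((fun r : Fin (i + 1) => M.st r.1 l ω),
                     (fun r : Fin i => M.st r.1 (j + 1) ω)))) ≤ M.MIC)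
    ∧ (M.MICcond ≤
        ∑ i ∈ Finset.range k, ∑ j ∈ Finset.range n, ∑ l ∈ Finset.range (j + 1),
          condMI p (M.st i (j + 1)) (X l)
            (fun ω => ((fun r : Fin (i + 1) => M.st r.1 l ω),
                       (fun r : Fin i => M.st r.1 (j + 1) ω))))
    ∧ (Fintype.card M.S ≤ 2 ^ s → M.MICcond ≤ k * s * n) := by
  have hle : M.MICcond ≤ ∑ i ∈ Finset.range k, ∑ j ∈ Finset.range n,
      ∑ l ∈ Finset.range (j + 1), condMI p (M.st i (j + 1)) (X l)
        (M.transcript l (j + 1) (i + 1) i) := by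
    rw [Finset.sum_comm, Alg.MICcond]
    refine Finset.sum_le_sum fun j hj => ?_
    rw [Finset.sum_comm]
    refine Finset.sum_le_sum fun l hl => ?_
    exact M.condMI_given_passEnd_le hp hprod (Finset.mem_range.1 hl) (Finset.mem_range.1 hj)
  refine ⟨?_, hle, fun hs => hle.trans ?_⟩
  · rw [Alg.MIC]
    exact le_add_of_nonneg_right (Finset.sum_nonneg fun i _ => Finset.sum_nonneg fun j _ =>
      Finset.sum_nonneg fun l _ => hp.condMI_nonneg _ _ _)
  · obtain ⟨ω₀⟩ : Nonempty Ω := by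
      by_contra h
      rw [not_nonempty_iff] at h
      simpa using hp.sum_one
    have hcard : Real.logb 2 (Fintype.card M.S) ≤ s := by
      have hpos : (0 : ℝ) < Fintype.card M.S := by
        exact_mod_cast Fintype.card_pos_iff.2 ⟨M.init ω₀⟩
      rw [Real.logb_le_iff_le_rpow (by norm_num) hpos, Real.rpow_natCast]
      exact_mod_cast hs
    calc _ ≤ ∑ i ∈ Finset.range k, ∑ j ∈ Finset.range n, (s : ℝ) :=
          Finset.sum_le_sum fun i _ => Finset.sum_le_sum fun j hj =>
            (M.sum_condMI_le_logb_card hp hprod (Finset.mem_range.1 hj) i).trans hcard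
      _ = k * s * n := by
          simp only [Finset.sum_const, Finset.card_range, nsmul_eq_mul]
          ring

end MultiPassIC
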